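/- Let k ≥ 2 and let G_1, …, G_ℓ be graphs on the same finite vertex set V, where G_i has m_i edges. Then there exists a partition of V into k classes V_1, …, V_k such that for every i = 1, …, ℓ the number of edges of G_i whose endvertices lie in two different classes is at least (k−1)·m_i/k − √(2ℓ·m_i). -/

import Mathlib

/-- `crossCount G P` is the number of edges of `G` whose endvertices lie in two
different classes of the family `P` of vertex classes. -/
def crossCount {V : Type*} [Fintype V] [DecidableEq V] {k : ℕ} (G : SimpleGraph V)
    [DecidableRel G.Adj] (P : Fin k → Finset V) : ℕ :=
  (G.edgeFinset.filter fun e =>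
    ∃ s t : Fin k, s ≠ t ∧ ∃ a ∈ P s, ∃ b ∈ P t, e = s(a, b)).card

open Classical in
/-- centred indicator that `e` is monochromatic under `f` -/
noncomputable def monoX {V : Type*} {k : ℕ} (f : V → Fin k) (e : Sym2 V) : ℝ :=
  (if (e.map f).IsDiag then 1 else 0) - 1 / (k : ℝ)

lemma monoX_sq_le {V : Type*} {k : ℕ} (hk : 2 ≤ k) (f : V → Fin k) (e : Sym2 V) :
    monoX f e * monoX f e ≤ 1 := by
  have h0 : (0 : ℝ) ≤ 1 / (k : ℝ) := by positivity
  have h1 : 1 / (k : ℝ) ≤ 1 := by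
    have : (2 : ℝ) ≤ k := by exact_mod_cast hk
    rw [div_le_one (by linarith)]
    linarith
  unfold monoX
  split_ifs <;> nlinarith

lemma exists_sep {V : Type*} (e e' : Sym2 V) (he : ¬ e.IsDiag) (hne : e ≠ e') :
    ∃ a b, e = s(a, b) ∧ a ≠ b ∧ a ∉ e' := by
  induction e using Sym2.ind with
  | _ x y =>
    have hxy : x ≠ y := by simpa using he
    by_cases hx : x ∈ e'
    · refine ⟨y, x, Sym2.eq_swap, hxy.symm, fun hy => hne ?_⟩
      exact ((Sym2.mem_and_mem_iff hxy).1 ⟨hx, hy⟩).symm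
    · exact ⟨x, y, rfl, hxy, hx⟩

lemma monoX_orth {V : Type*} [Fintype V] [DecidableEq V] {k : ℕ} (hk : 2 ≤ k)
    (e e' : Sym2 V) (he : ¬ e.IsDiag) (hne : e ≠ e') :
    ∑ f : V → Fin k, monoX f e * monoX f e' = 0 := by
  haveI : NeZero k := ⟨by omega⟩
  have hk0 : (k : ℝ) ≠ 0 := by exact_mod_cast (NeZero.ne k)
  obtain ⟨a, b, rfl, hab, ha⟩ := exists_sep e e' he hne
  have h1 : ∀ c : Fin k, ∑ f : V → Fin k, monoX (f + Pi.single a c) s(a, b) * monoX f e'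
      = ∑ f : V → Fin k, monoX f s(a, b) * monoX f e' := by
    intro c
    rw [← Equiv.sum_comp (Equiv.addRight (Pi.single a c : V → Fin k))
      (fun f => monoX f s(a, b) * monoX f e')]
    refine Finset.sum_congr rfl fun f _ => ?_
    have : Sym2.map (f + Pi.single a c) e' = Sym2.map f e' := by
      refine Sym2.map_congr fun x hx => ?_
      have : x ≠ a := fun h => ha (h ▸ hx)
      simp [this]
    simp only [Equiv.coe_addRight]
    congr 1
    unfold monoX
    rw [this]
  have h2 : ∀ f : V → Fin k, ∑ c : Fin k, monoX (f + Pi.single a c) s(a, b) = 0 := by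
    intro f
    have : ∀ c : Fin k, monoX (f + Pi.single a c) s(a, b)
        = (if c = f b - f a then 1 else 0) - 1 / (k : ℝ) := by
      intro c
      unfold monoX
      congr 1
      have : (Sym2.map (f + Pi.single a c) s(a, b)).IsDiag ↔ c = f b - f a := by
        simp [hab.symm, eq_sub_iff_add_eq, add_comm]
      simp only [this]
    simp only [this, Finset.sum_sub_distrib]
    simp [hk0]
  have h3 : (k : ℝ) * ∑ f : V → Fin k, monoX f s(a, b) * monoX f e' = 0 := by
    calc (k : ℝ) * ∑ f : V → Fin k, monoX f s(a, b) * monoX f e'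
        = ∑ c : Fin k, ∑ f : V → Fin k, monoX (f + Pi.single a c) s(a, b) * monoX f e' := by
          simp [h1]
      _ = 0 := by
          rw [Finset.sum_comm]
          simp [← Finset.sum_mul, h2]
  exact (mul_eq_zero.1 h3).resolve_left hk0

lemma second_moment {V : Type*} [Fintype V] [DecidableEq V] {k : ℕ} (hk : 2 ≤ k)
    (E : Finset (Sym2 V)) (hE : ∀ e ∈ E, ¬ e.IsDiag) :
    ∑ f : V → Fin k, (∑ e ∈ E, monoX f e) ^ 2 ≤ Fintype.card (V → Fin k) * (E.card : ℝ) := by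
  calc ∑ f : V → Fin k, (∑ e ∈ E, monoX f e) ^ 2
      = ∑ e ∈ E, ∑ e' ∈ E, ∑ f : V → Fin k, monoX f e * monoX f e' := by
        simp only [sq, Finset.sum_mul_sum]
        rw [Finset.sum_comm]
        refine Finset.sum_congr rfl fun e _ => ?_
        rw [Finset.sum_comm]
    _ = ∑ e ∈ E, ∑ f : V → Fin k, monoX f e * monoX f e := by
        refine Finset.sum_congr rfl fun e he => ?_
        refine Finset.sum_eq_single_of_mem e he fun e' _ hne => ?_
        exact monoX_orth hk e e' (hE e he) hne.symm
    _ ≤ ∑ e ∈ E, ∑ f : V → Fin k, (1 : ℝ) :=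
        Finset.sum_le_sum fun e _ => Finset.sum_le_sum fun f _ => monoX_sq_le hk f e
    _ = _ := by simp [mul_comm]

lemma crossCount_eq {V : Type*} [Fintype V] [DecidableEq V] {k : ℕ} (G : SimpleGraph V)
    [DecidableRel G.Adj] (hk : 2 ≤ k) (f : V → Fin k) :
    (crossCount G (fun s => Finset.univ.filter fun v => f v = s) : ℝ)
      = ((k : ℝ) - 1) * G.edgeFinset.card / k - ∑ e ∈ G.edgeFinset, monoX f e := by
  classical
  have hk0 : (k : ℝ) ≠ 0 := by
    have : k ≠ 0 := by omega
    exact_mod_cast this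
  have h1 : crossCount G (fun s => Finset.univ.filter fun v => f v = s)
      = (G.edgeFinset.filter fun e => ¬ (e.map f).IsDiag).card := by
    unfold crossCount
    congr 1
    refine Finset.filter_congr fun e _ => ?_
    constructor
    · rintro ⟨s, t, hst, a, ha, b, hb, rfl⟩
      simp at ha hb
      simp [ha, hb, hst]
    · induction e using Sym2.ind with
      | _ x y =>
        intro h
        exact ⟨f x, f y, by simpa using h, x, by simp, y, by simp, rfl⟩
  have h2 := Finset.card_filter_add_card_filter_not (s := G.edgeFinset)
    (fun e => (e.map f).IsDiag)
  have h3 : ((G.edgeFinset.filter fun e => (e.map f).IsDiag).card : ℝ)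
      + ((G.edgeFinset.filter fun e => ¬ (e.map f).IsDiag).card : ℝ) = G.edgeFinset.card := by
    exact_mod_cast h2
  have h4 : ∑ e ∈ G.edgeFinset, monoX f e
      = ((G.edgeFinset.filter fun e => (e.map f).IsDiag).card : ℝ) - G.edgeFinset.card / k := by
    unfold monoX
    rw [Finset.sum_sub_distrib, Finset.sum_boole]
    simp [div_eq_mul_inv]
  rw [h1, h4, ← h3]
  field_simp
  ring

theorem simultaneous_kpartition {V : Type*} [Fintype V] [DecidableEq V]
    (k : ℕ) (hk : 2 ≤ k) (ℓ : ℕ)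
    (G : Fin ℓ → SimpleGraph V) [∀ i, DecidableRel (G i).Adj]
    (m : Fin ℓ → ℕ) (hm : ∀ i, (G i).edgeFinset.card = m i) :
    ∃ P : Fin k → Finset V,
      (∀ s t : Fin k, s ≠ t → Disjoint (P s) (P t)) ∧
      Finset.univ.biUnion P = Finset.univ ∧
      ∀ i, (crossCount (G i) P : ℝ) ≥
        ((k : ℝ) - 1) * m i / k - Real.sqrt (2 * ℓ * m i) := by
  haveI : NeZero k := ⟨by omega⟩
  let S : Fin ℓ → (V → Fin k) → ℝ := fun i f => ∑ e ∈ (G i).edgeFinset, monoX f e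
  have hS : ∀ i, ∑ f, S i f ^ 2 ≤ Fintype.card (V → Fin k) * (m i : ℝ) := by
    intro i
    have := second_moment hk (G i).edgeFinset (fun e he => (G i).not_isDiag_of_mem_edgeFinset he)
    rwa [hm i] at this
  have hex : ∃ f ∈ (Finset.univ : Finset (V → Fin k)), ∑ i, S i f ^ 2 / m i ≤ (ℓ : ℝ) := by
    refine Finset.exists_le_of_sum_le Finset.univ_nonempty ?_
    rw [Finset.sum_comm]
    calc ∑ i, ∑ f, S i f ^ 2 / (m i : ℝ) ≤ ∑ i : Fin ℓ, (Fintype.card (V → Fin k) : ℝ) := by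
          refine Finset.sum_le_sum fun i _ => ?_
          rw [← Finset.sum_div]
          exact div_le_of_le_mul₀ (by positivity) (by positivity) (hS i)
      _ = _ := by simp [mul_comm]
  obtain ⟨f, -, hf⟩ := hex
  refine ⟨fun s => Finset.univ.filter fun v => f v = s, ?_, ?_, ?_⟩
  · intro s t hst
    rw [Finset.disjoint_left]
    intro v hv hv'
    simp at hv hv'
    exact hst (hv.symm.trans hv')
  · ext v
    simp
  · intro i
    rw [crossCount_eq (G i) hk f, hm i]
    have hle : S i f ≤ Real.sqrt (2 * ℓ * m i) := by
      rcases Nat.eq_zero_or_pos (m i) with h0 | hpos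
      · have hE : (G i).edgeFinset = ∅ := Finset.card_eq_zero.1 ((hm i).trans h0)
        have : S i f = 0 := by
          simp only [S, hE, Finset.sum_empty]
        rw [this]
        positivity
      · have hmp : (0 : ℝ) < m i := by exact_mod_cast hpos
        have h1 : S i f ^ 2 / m i ≤ ℓ :=
          (Finset.single_le_sum (f := fun i => S i f ^ 2 / (m i : ℝ))
            (fun j _ => by positivity) (Finset.mem_univ i)).trans hf
        rw [div_le_iff₀ hmp] at h1
        refine Real.le_sqrt_of_sq_le ?_
        have : (0 : ℝ) ≤ ℓ * m i := by positivity
        linarith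
    have : ∑ e ∈ (G i).edgeFinset, monoX f e = S i f := rfl
    rw [this]
    linarith
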